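/- Let e ≥ 2 and let λ be an e-restricted partition of d. Then in ℤ[q,q^{−1}], the sum of q^{deg(T)} over all standard λ-tableaux T whose residue sequence i^T equals the ladder weight j^λ is equal to r_λ = ∏_{m=1}^{t_λ} [r_m(λ)]_q!. -/

import Mathlib

namespace KN

/-- A subset of `ℤ²_{≥1}` (encoded in `ℕ × ℕ`) shaped like a Young diagram:
all coordinates are `≥ 1` and the set is closed under decreasing either coordinate
(staying `≥ 1`). -/
def IsDiagram (S : Set (ℕ × ℕ)) : Prop :=
  (∀ p ∈ S, 1 ≤ p.1 ∧ 1 ≤ p.2) ∧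
  ∀ a b a' b', (a, b) ∈ S → 1 ≤ a' → a' ≤ a → 1 ≤ b' → b' ≤ b → (a', b') ∈ S

/-- The Young diagram of a partition given as a function `l : ℕ → ℕ`
(`l r` is the `r`-th part, for `r ≥ 1`): the nodes `(a, b)` with `a, b ≥ 1`, `b ≤ l a`. -/
def cells (l : ℕ → ℕ) : Set (ℕ × ℕ) := {p | 1 ≤ p.1 ∧ 1 ≤ p.2 ∧ p.2 ≤ l p.1}

/-- `l` (indexed from `1`) is a weakly decreasing sequence of naturals, eventually zero. -/
def IsPartitionFun (l : ℕ → ℕ) : Prop :=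
  (∀ r, 1 ≤ r → l (r + 1) ≤ l r) ∧ ∃ N, ∀ r, N ≤ r → l r = 0

/-- `l` is a partition of `d`: its Young diagram has exactly `d` nodes. -/
def IsPartitionOf (l : ℕ → ℕ) (d : ℕ) : Prop :=
  IsPartitionFun l ∧ (cells l).Finite ∧ (cells l).ncard = d

/-- `λ_r - λ_{r+1} < e` for all `r ≥ 1`. -/
def IsRestricted (e : ℕ) (l : ℕ → ℕ) : Prop := ∀ r, 1 ≤ r → l r < l (r + 1) + e

/-- The `m`-th ladder `L_m = {(1 + k, m - k(e-1)) : k ≥ 0, k(e-1) < m}`. -/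
def ladder (e m : ℕ) : Set (ℕ × ℕ) :=
  {p | ∃ k : ℕ, k * (e - 1) < m ∧ p = (1 + k, m - k * (e - 1))}

/-- The residue `b - a (mod e)` of a node `(a, b)`. -/
def res (e : ℕ) (p : ℕ × ℕ) : ZMod e := (p.2 : ZMod e) - (p.1 : ZMod e)

/-- `A` is a removable node of the diagram `S`. -/
def Removable (S : Set (ℕ × ℕ)) (A : ℕ × ℕ) : Prop := A ∈ S ∧ IsDiagram (S \ {A})

/-- `B` is an addable node of the diagram `S`. -/
def Addable (S : Set (ℕ × ℕ)) (B : ℕ × ℕ) : Prop := B ∉ S ∧ IsDiagram (S ∪ {B})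

/-- `σ_k` of a diagram: the number of nodes in rows `1, …, k`. -/
noncomputable def sigmaSet (S : Set (ℕ × ℕ)) (k : ℕ) : ℕ := (S ∩ {p | p.1 ≤ k}).ncard

/-- Dominance order on diagrams: `S ⊴ T` iff `σ_k(S) ≤ σ_k(T)` for all `k`. -/
def DomLE (S T : Set (ℕ × ℕ)) : Prop := ∀ k, sigmaSet S k ≤ sigmaSet T k

/-- `R_m = r_1(λ) + ⋯ + r_m(λ)` where `r_u(λ) = |λ ∩ L_u|`. -/
noncomputable def Rlad (e : ℕ) (l : ℕ → ℕ) (m : ℕ) : ℕ :=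
  ∑ u ∈ Finset.Icc 1 m, (cells l ∩ ladder e u).ncard

/-- The `s`-th entry of the ladder weight `j^λ`: it equals `m - 1 (mod e)` for the
unique `m` with `R_{m-1} < s ≤ R_m`. -/
noncomputable def ladderWeight (e : ℕ) (l : ℕ → ℕ) (s : ℕ) : ZMod e :=
  ((sInf {m : ℕ | s ≤ Rlad e l m} - 1 : ℕ) : ZMod e)

/-- A standard tableau of shape `S` (with `|S| = d`): a bijective labelling of the
nodes of `S` by `1, …, d`, increasing along rows and columns. -/
def IsStandardTableau (S : Set (ℕ × ℕ)) (d : ℕ) (T : ℕ × ℕ → ℕ) : Prop :=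
  (∀ p ∈ S, 1 ≤ T p ∧ T p ≤ d) ∧
  (∀ p ∈ S, ∀ q ∈ S, T p = T q → p = q) ∧
  (∀ s, 1 ≤ s → s ≤ d → ∃ p ∈ S, T p = s) ∧
  (∀ a b, (a, b) ∈ S → (a, b + 1) ∈ S → T (a, b) < T (a, b + 1)) ∧
  (∀ a b, (a, b) ∈ S → (a + 1, b) ∈ S → T (a, b) < T (a + 1, b))

/-- The degree `d_A(S)` of a removable node `A` of `S`:
(number of addable nodes of `S` of the same residue strictly below `A`) minus
(number of removable nodes of `S` of the same residue strictly below `A`). -/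
noncomputable def degNode (e : ℕ) (S : Set (ℕ × ℕ)) (A : ℕ × ℕ) : ℤ :=
  (({B | Addable S B ∧ res e B = res e A ∧ A.1 < B.1}).ncard : ℤ) -
  (({B | Removable S B ∧ res e B = res e A ∧ A.1 < B.1}).ncard : ℤ)

/-- The degree of a standard tableau: `deg(T) = Σ_{s=1}^d d_{A_s}(sh(T_{≤ s}))`,
written as a sum over the nodes `p` of `S` (with `s = T p`). -/
noncomputable def degTab (e : ℕ) (S : Set (ℕ × ℕ)) (T : ℕ × ℕ → ℕ) : ℤ :=
  ∑ᶠ p ∈ S, degNode e {q | q ∈ S ∧ T q ≤ T p} p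

/-- The set of standard tableaux of shape `S` (of size `d`) whose residue sequence
equals the ladder weight `j^λ` of the partition `l`; tableaux are normalized to
take the value `0` off `S`. -/
def LWTableaux (e d : ℕ) (l : ℕ → ℕ) (S : Set (ℕ × ℕ)) : Set ((ℕ × ℕ) → ℕ) :=
  {T | IsStandardTableau S d T ∧ (∀ p, p ∉ S → T p = 0) ∧
    ∀ p ∈ S, res e p = ladderWeight e l (T p)}

/-- The quantum integer `[n]_q = q^{n-1} + q^{n-3} + ⋯ + q^{1-n} ∈ ℤ[q, q⁻¹]`. -/
noncomputable def qint (n : ℕ) : LaurentPolynomial ℤ :=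
  ∑ k ∈ Finset.range n, LaurentPolynomial.T ((n : ℤ) - 1 - 2 * k)

/-- The quantum factorial `[n]_q! = [n]_q [n-1]_q ⋯ [1]_q`. -/
noncomputable def qfact (n : ℕ) : LaurentPolynomial ℤ :=
  ∏ k ∈ Finset.Icc 1 n, qint k

/-- ladder index of a node -/
def lad (e : ℕ) (p : ℕ × ℕ) : ℕ := (p.1 - 1) * (e - 1) + p.2

/-- abstract ladder tableaux on a finite set `X` -/
def Tab {α : Type*} (f : α → ℕ) (X : Finset α) : Set (α → ℕ) :=
  {T | (∀ p ∈ X, 1 ≤ T p ∧ T p ≤ X.card) ∧ Set.InjOn T (X : Set α) ∧ (∀ p, p ∉ X → T p = 0) ∧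
    ∀ p ∈ X, ∀ q ∈ X, f p < f q → T p < T q}

/-- contribution of a pair -/
def hh {α : Type*} (f g : α → ℕ) (T : α → ℕ) (p q : α) : ℤ :=
  if f q = f p ∧ g p < g q then (if T p < T q then 1 else if T q < T p then -1 else 0) else 0

/-- abstract weight -/
def wt {α : Type*} (f g : α → ℕ) (X : Finset α) (T : α → ℕ) : ℤ :=
  ∑ p ∈ X, ∑ q ∈ X, hh f g T p q

theorem rank_sum {α M : Type*} [DecidableEq α] [AddCommMonoid M] (g : α → ℕ) (F : ℕ → M)
    (S : Finset α) (hg : Set.InjOn g (S : Set α)) :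
    ∑ A ∈ S, F ((S.filter (fun p => g A < g p)).card) = ∑ k ∈ Finset.range S.card, F k := by
  induction S using Finset.induction_on_min_value g with
  | empty => simp
  | insert a s ha hmin ih =>
    have hlt : ∀ x ∈ s, g a < g x := by
      intro x hx
      refine lt_of_le_of_ne (hmin x hx) ?_
      intro h
      have := hg (by simp) (by simp [hx]) h
      exact ha (this ▸ hx)
    rw [Finset.sum_insert ha, Finset.card_insert_of_notMem ha, Finset.sum_range_succ, add_comm]
    congr 1
    · rw [← ih (hg.mono (by simp))]
      apply Finset.sum_congr rfl
      intro x hx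
      congr 2
      rw [Finset.filter_insert, if_neg]
      have := hlt x hx
      omega
    · congr 1
      rw [Finset.filter_insert, if_neg (lt_irrefl _), Finset.filter_true_of_mem hlt]

theorem count_le {α : Type*} (X : Finset α) (T : α → ℕ)
    (h1 : ∀ p ∈ X, 1 ≤ T p ∧ T p ≤ X.card) (h2 : Set.InjOn T (X : Set α)) :
    (∀ s, 1 ≤ s → s ≤ X.card → ∃ p ∈ X, T p = s) ∧
    ∀ k, k ≤ X.card → (X.filter (fun q => T q ≤ k)).card = k := by
  classical
  have him : X.image T = Finset.Icc 1 X.card := by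
    apply Finset.eq_of_subset_of_card_le
    · intro x hx
      obtain ⟨p, hp, rfl⟩ := Finset.mem_image.1 hx
      exact Finset.mem_Icc.2 (h1 p hp)
    · rw [Finset.card_image_of_injOn h2]; simp
  have hs : ∀ s, 1 ≤ s → s ≤ X.card → ∃ p ∈ X, T p = s := by
    intro s a b
    have : s ∈ X.image T := by rw [him]; exact Finset.mem_Icc.2 ⟨a, b⟩
    simpa using this
  refine ⟨hs, ?_⟩
  intro k hk
  have : (X.filter (fun q => T q ≤ k)).image T = Finset.Icc 1 k := by
    ext s
    simp only [Finset.mem_image, Finset.mem_filter, Finset.mem_Icc]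
    constructor
    · rintro ⟨p, ⟨hp, hk⟩, rfl⟩
      exact ⟨(h1 p hp).1, hk⟩
    · rintro ⟨a, b⟩
      obtain ⟨p, hp, rfl⟩ := hs s a (b.trans hk)
      exact ⟨p, ⟨hp, b⟩, rfl⟩
  rw [← Finset.card_image_of_injOn (h2.mono (Finset.coe_subset.2 (Finset.filter_subset _ _))), this]
  simp

theorem tab_decomp {α : Type*} [DecidableEq α] (f : α → ℕ) (X : Finset α) (M : ℕ)
    (hM : ∀ p ∈ X, f p ≤ M) (hM' : ∃ p ∈ X, f p = M) :
    Tab f X = ⋃ A ∈ ((X.filter (fun p => f p = M) : Finset α) : Set α),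
      (fun T => Function.update T A X.card) '' Tab f (X.erase A) := by
  ext T
  simp only [Set.mem_iUnion, Set.mem_image, Finset.coe_filter, Set.mem_ofPred_eq, exists_prop]
  have hpos : 1 ≤ X.card := by
    obtain ⟨p, hp, _⟩ := hM'
    exact Finset.card_pos.2 ⟨p, hp⟩
  constructor
  · rintro ⟨h1, h2, h3, h4⟩
    obtain ⟨A, hA, hTA⟩ := (count_le X T h1 h2).1 X.card hpos le_rfl
    have hfA : f A = M := by
      obtain ⟨p, hp, hpM⟩ := hM'
      by_contra hne
      have := h4 A hA p hp (by have := hM A hA; omega)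
      have := (h1 p hp).2
      omega
    refine ⟨A, ⟨hA, hfA⟩, Function.update T A 0, ⟨?_, ?_, ?_, ?_⟩, ?_⟩
    · intro p hp
      obtain ⟨hpA, hp⟩ := Finset.mem_erase.1 hp
      rw [Function.update_of_ne hpA, Finset.card_erase_of_mem hA]
      have := h1 p hp
      have : T p ≠ X.card := fun h => hpA (h2 hp hA (h.trans hTA.symm))
      omega
    · intro p hp q hq hpq
      obtain ⟨hpA, hp⟩ := Finset.mem_erase.1 hp
      obtain ⟨hqA, hq⟩ := Finset.mem_erase.1 hq
      rw [Function.update_of_ne hpA, Function.update_of_ne hqA] at hpq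
      exact h2 hp hq hpq
    · intro p hp
      by_cases hpA : p = A
      · subst hpA; simp
      · rw [Function.update_of_ne hpA]
        exact h3 p (fun h => hp (Finset.mem_erase.2 ⟨hpA, h⟩))
    · intro p hp q hq hpq
      obtain ⟨hpA, hp⟩ := Finset.mem_erase.1 hp
      obtain ⟨hqA, hq⟩ := Finset.mem_erase.1 hq
      rw [Function.update_of_ne hpA, Function.update_of_ne hqA]
      exact h4 p hp q hq hpq
    · simp only [Function.update_idem]
      rw [← hTA, Function.update_eq_self]
  · rintro ⟨A, ⟨hA, hfA⟩, T, ⟨h1, h2, h3, h4⟩, rfl⟩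
    rw [Finset.card_erase_of_mem hA] at h1
    refine ⟨?_, ?_, ?_, ?_⟩
    · intro p hp
      by_cases hpA : p = A
      · subst hpA; simpa using hpos
      · rw [Function.update_of_ne hpA]
        have := h1 p (Finset.mem_erase.2 ⟨hpA, hp⟩)
        omega
    · intro p hp q hq hpq
      by_cases hpA : p = A <;> by_cases hqA : q = A
      · rw [hpA, hqA]
      · subst hpA
        rw [Function.update_of_ne hqA, Function.update_self] at hpq
        have := h1 q (Finset.mem_erase.2 ⟨hqA, hq⟩)
        omega
      · subst hqA
        rw [Function.update_of_ne hpA, Function.update_self] at hpq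
        have := h1 p (Finset.mem_erase.2 ⟨hpA, hp⟩)
        omega
      · rw [Function.update_of_ne hpA, Function.update_of_ne hqA] at hpq
        exact h2 (Finset.mem_erase.2 ⟨hpA, hp⟩) (Finset.mem_erase.2 ⟨hqA, hq⟩) hpq
    · intro p hp
      have hpA : p ≠ A := fun h => hp (h ▸ hA)
      rw [Function.update_of_ne hpA]
      exact h3 p (fun h => hp (Finset.mem_of_mem_erase h))
    · intro p hp q hq hpq
      have hpA : p ≠ A := by
        rintro rfl
        have := hM q hq
        omega
      rw [Function.update_of_ne hpA]
      have hp1 := h1 p (Finset.mem_erase.2 ⟨hpA, hp⟩)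
      by_cases hqA : q = A
      · subst hqA
        rw [Function.update_self]
        omega
      · rw [Function.update_of_ne hqA]
        exact h4 p (Finset.mem_erase.2 ⟨hpA, hp⟩) q (Finset.mem_erase.2 ⟨hqA, hq⟩) hpq

theorem wt_update {α : Type*} [DecidableEq α] (f g : α → ℕ) (X : Finset α) (M : ℕ)
    (hinj : ∀ p ∈ X, ∀ q ∈ X, f p = f q → g p = g q → p = q)
    (A : α) (hA : A ∈ X) (hfA : f A = M) (T : α → ℕ) (hT : T ∈ Tab f (X.erase A)) :
    wt f g X (Function.update T A X.card) = wt f g (X.erase A) T +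
      (((X.filter (fun p => f p = M)).card : ℤ) - 1 -
        2 * (((X.filter (fun p => f p = M)).filter (fun p => g A < g p)).card : ℕ)) := by
  obtain ⟨h1, h2, h3, h4⟩ := hT
  have hlt : ∀ p ∈ X.erase A, T p < X.card := by
    intro p hp
    have := (h1 p hp).2
    rw [Finset.card_erase_of_mem hA] at this
    have := Finset.card_pos.2 ⟨A, hA⟩
    omega
  set Y := X.erase A with hY
  have hXY : X = insert A Y := (Finset.insert_erase hA).symm
  have hAY : A ∉ Y := by simp [hY]
  set n := X.card with hn
  set T' := Function.update T A n with hT'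
  have hTA : T' A = n := by simp [hT']
  have hTp : ∀ p ∈ Y, T' p = T p := by
    intro p hp
    rw [hT', Function.update_of_ne]
    rintro rfl; exact hAY hp
  have e1 : ∑ q ∈ Y, hh f g T' A q = - ((Y.filter (fun p => f p = M ∧ g A < g p)).card : ℤ) := by
    rw [Finset.card_filter]
    push_cast
    rw [← Finset.sum_neg_distrib]
    apply Finset.sum_congr rfl
    intro q hq
    have := hlt q hq
    unfold hh
    rw [hTA, hTp q hq, hfA]
    split_ifs <;> first | rfl | omega
  have e2 : ∑ p ∈ Y, hh f g T' p A = ((Y.filter (fun p => f p = M ∧ g p < g A)).card : ℤ) := by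
    rw [Finset.card_filter]
    push_cast
    apply Finset.sum_congr rfl
    intro q hq
    have := hlt q hq
    unfold hh
    rw [hTA, hTp q hq, hfA]
    split_ifs <;> first | rfl | omega
  have e3 : ∑ p ∈ Y, ∑ q ∈ Y, hh f g T' p q = wt f g Y T := by
    unfold wt
    apply Finset.sum_congr rfl
    intro p hp
    apply Finset.sum_congr rfl
    intro q hq
    unfold hh
    rw [hTp p hp, hTp q hq]
  have e4 : wt f g X T' = ∑ q ∈ Y, hh f g T' A q + ∑ p ∈ Y, hh f g T' p A
      + ∑ p ∈ Y, ∑ q ∈ Y, hh f g T' p q := by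
    unfold wt
    rw [hXY, Finset.sum_insert hAY, Finset.sum_insert hAY]
    have : ∀ p ∈ Y, ∑ q ∈ insert A Y, hh f g T' p q = hh f g T' p A + ∑ q ∈ Y, hh f g T' p q :=
      fun p _ => Finset.sum_insert hAY
    rw [Finset.sum_congr rfl this, Finset.sum_add_distrib]
    have : hh f g T' A A = 0 := by simp [hh]
    rw [this]; ring
  have e5 : ((X.filter (fun p => f p = M)).filter (fun p => g A < g p))
      = (Y.filter (fun p => f p = M ∧ g A < g p)) := by
    rw [hXY, Finset.filter_filter, Finset.filter_insert, if_neg]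
    simp
  have e6 : (X.filter (fun p => f p = M)).card
      = (Y.filter (fun p => f p = M ∧ g A < g p)).card
        + (Y.filter (fun p => f p = M ∧ g p < g A)).card + 1 := by
    have e7 : X.filter (fun p => f p = M) = insert A (Y.filter (fun p => f p = M ∧ g A < g p) ∪
        Y.filter (fun p => f p = M ∧ g p < g A)) := by
      ext p
      rw [hXY]
      simp only [Finset.mem_filter, Finset.mem_insert, Finset.mem_union]
      constructor
      · rintro ⟨rfl | hp, h⟩
        · exact Or.inl rfl
        · right
          have : g p ≠ g A := by
            intro h'
            have hpX : p ∈ X := by rw [hXY]; simp [hp]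
            have := hinj p hpX A hA (h.trans hfA.symm) h'
            exact hAY (this ▸ hp)
          rcases lt_or_gt_of_ne this with h' | h'
          · exact Or.inr ⟨hp, h, h'⟩
          · exact Or.inl ⟨hp, h, h'⟩
      · rintro (rfl | ⟨hp, h, _⟩ | ⟨hp, h, _⟩)
        · exact ⟨Or.inl rfl, hfA⟩
        · exact ⟨Or.inr hp, h⟩
        · exact ⟨Or.inr hp, h⟩
    rw [e7, Finset.card_insert_of_notMem (by simp [hAY]), Finset.card_union_of_disjoint]
    rw [Finset.disjoint_left]
    intro p hp hp'
    have := (Finset.mem_filter.1 hp).2.2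
    have := (Finset.mem_filter.1 hp').2.2
    omega
  rw [e4, e1, e2, e3, e5, e6]
  push_cast
  ring

theorem tab_sum {α : Type*} [DecidableEq α] (f g : α → ℕ) (n : ℕ) : ∀ (X : Finset α),
    X.card = n →
    (∀ p ∈ X, ∀ q ∈ X, f p = f q → g p = g q → p = q) →
    (Tab f X).Finite ∧ ∀ U : Finset ℕ, (∀ p ∈ X, f p ∈ U) →
      ∑ᶠ T ∈ Tab f X, LaurentPolynomial.T (R := ℤ) (wt f g X T) =
        ∏ u ∈ U, qfact ((X.filter (fun p => f p = u)).card) := by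
  induction n with
  | zero =>
    intro X hX _
    rw [Finset.card_eq_zero] at hX
    subst hX
    have : Tab f (∅ : Finset α) = {fun _ => 0} := by
      ext T
      simp only [Tab, Set.mem_ofPred_eq, Set.mem_singleton_iff]
      constructor
      · rintro ⟨_, _, h, _⟩
        funext p
        exact h p (by simp)
      · rintro rfl
        simp
    rw [this]
    refine ⟨Set.finite_singleton _, ?_⟩
    intro U _
    rw [finsum_mem_singleton]
    simp [wt, qfact]
  | succ n ih =>
    intro X hX hinj
    have hne : X.Nonempty := Finset.card_pos.1 (by omega)
    obtain ⟨P, hP, hPmax⟩ := Finset.exists_max_image X f hne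
    set M := f P with hMdef
    have hdec := tab_decomp f X M hPmax ⟨P, hP, rfl⟩
    have ih' : ∀ A ∈ X.filter (fun p => f p = M), _ := fun A hA =>
      ih (X.erase A) (by rw [Finset.card_erase_of_mem (Finset.mem_filter.1 hA).1]; omega)
      (fun p hp q hq => hinj p (Finset.mem_of_mem_erase hp) q (Finset.mem_of_mem_erase hq))
    have hfin : ∀ A ∈ ((X.filter (fun p => f p = M) : Finset α) : Set α),
        ((fun T => Function.update T A X.card) '' Tab f (X.erase A)).Finite :=
      fun A hA => (ih' A hA).1.image _
    refine ⟨?_, ?_⟩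
    · rw [hdec]
      exact Set.Finite.biUnion (Finset.finite_toSet _) hfin
    intro U hU
    rw [hdec, finsum_mem_biUnion _ (Finset.finite_toSet _) hfin]
    swap
    · intro A hA B hB hAB
      rw [Function.onFun, Set.disjoint_left]
      rintro _ ⟨T, hT, rfl⟩ ⟨T', hT', hTT⟩
      have hA' := (Finset.mem_filter.1 hA).1
      have hB' := (Finset.mem_filter.1 hB).1
      have h1 := congrFun hTT A
      simp only [Function.update_self, Function.update_of_ne hAB] at h1
      have h2 := (hT'.1 A (Finset.mem_erase.2 ⟨hAB, hA'⟩)).2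
      rw [Finset.card_erase_of_mem hB'] at h2
      omega
    rw [finsum_mem_coe_finset]
    have hMU : M ∈ U := hU P hP
    have key : ∀ A ∈ X.filter (fun p => f p = M),
        ∑ᶠ T ∈ (fun T => Function.update T A X.card) '' Tab f (X.erase A),
          LaurentPolynomial.T (R := ℤ) (wt f g X T) =
        (qfact ((X.filter (fun p => f p = M)).card - 1) *
          ∏ u ∈ U.erase M, qfact ((X.filter (fun p => f p = u)).card)) *
        LaurentPolynomial.T (((X.filter (fun p => f p = M)).card : ℤ) - 1 -
        2 * (((X.filter (fun p => f p = M)).filter (fun p => g A < g p)).card : ℕ)) := by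
      intro A hA
      obtain ⟨hAX, hfA⟩ := Finset.mem_filter.1 hA
      rw [finsum_mem_image]
      swap
      · intro T hT T' hT' hTT
        funext p
        by_cases hp : p = A
        · subst hp
          rw [hT.2.2.1 p (by simp), hT'.2.2.1 p (by simp)]
        · have := congrFun hTT p
          simpa only [Function.update_of_ne hp] using this
      have : ∀ T ∈ Tab f (X.erase A),
          LaurentPolynomial.T (R := ℤ) (wt f g X (Function.update T A X.card)) =
          LaurentPolynomial.T (wt f g (X.erase A) T) *
          LaurentPolynomial.T (((X.filter (fun p => f p = M)).card : ℤ) - 1 -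
        2 * (((X.filter (fun p => f p = M)).filter (fun p => g A < g p)).card : ℕ)) := by
        intro T hT
        rw [wt_update f g X M hinj A hAX hfA T hT, LaurentPolynomial.T_add]
      rw [finsum_mem_congr rfl this, ← finsum_mem_mul' _ _ (ih' A hA).1,
        (ih' A hA).2 U (fun p hp => hU p (Finset.mem_of_mem_erase hp)),
        ← Finset.mul_prod_erase U _ hMU]
      congr 2
      · rw [Finset.filter_erase, Finset.card_erase_of_mem hA]
      · apply Finset.prod_congr rfl
        intro u hu
        rw [Finset.filter_erase, Finset.erase_eq_of_notMem]
        simp only [Finset.mem_filter, hfA]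
        intro h
        exact (Finset.mem_erase.1 hu).1 h.2.symm
    rw [Finset.sum_congr rfl key, ← Finset.mul_sum,
      rank_sum g (fun k => LaurentPolynomial.T (R := ℤ)
        (((X.filter (fun p => f p = M)).card : ℤ) - 1 - 2 * (k : ℕ))),
      ← Finset.mul_prod_erase U _ hMU]
    · have hr : 0 < (X.filter (fun p => f p = M)).card :=
        Finset.card_pos.2 ⟨P, Finset.mem_filter.2 ⟨hP, rfl⟩⟩
      obtain ⟨r, hr⟩ := Nat.exists_eq_succ_of_ne_zero hr.ne'
      change _ * qint _ = _
      rw [hr]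
      have : qfact (r + 1) = qfact r * qint (r + 1) := by
        unfold qfact
        rw [Finset.prod_Icc_succ_top (by omega)]
      rw [Nat.succ_eq_add_one, this, Nat.add_sub_cancel]
      ring
    · intro p hp q hq hpq
      have hp := Finset.mem_filter.1 hp
      have hq := Finset.mem_filter.1 hq
      exact hinj p hp.1 q hq.1 (hp.2.trans hq.2.symm) hpq

theorem lad_inj (e : ℕ) (p q : ℕ × ℕ) (h : lad e p = lad e q) (h' : p.1 = q.1) : p = q := by
  unfold lad at h
  rw [h'] at h
  exact Prod.ext h' (by omega)

theorem lad_lt (e : ℕ) (he : 2 ≤ e) {a b a' b' : ℕ} (h1 : 1 ≤ a') (h2 : a' ≤ a) (h3 : b' ≤ b)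
    (hne : (a', b') ≠ (a, b)) : lad e (a', b') < lad e (a, b) := by
  unfold lad
  simp only
  rcases h2.lt_or_eq with h | h
  · have : (a' - 1) * (e - 1) < (a - 1) * (e - 1) := Nat.mul_lt_mul_of_pos_right (by omega) (by omega)
    omega
  · subst h
    have : b' ≠ b := by rintro rfl; exact hne rfl
    omega

theorem mem_ladder (e m : ℕ) (p : ℕ × ℕ) (h1 : 1 ≤ p.1) (h2 : 1 ≤ p.2) :
    p ∈ ladder e m ↔ lad e p = m := by
  obtain ⟨a, b⟩ := p
  simp only at h1 h2
  unfold ladder lad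
  simp only [Set.mem_ofPred_eq, Prod.mk.injEq]
  constructor
  · rintro ⟨k, hk, rfl, rfl⟩
    rw [Nat.add_sub_cancel_left]
    omega
  · rintro rfl
    exact ⟨a - 1, by omega, by omega, by omega⟩

theorem res_lad (e : ℕ) (he : 2 ≤ e) (p : ℕ × ℕ) (h1 : 1 ≤ p.1) :
    res e p = (lad e p : ZMod e) - 1 := by
  obtain ⟨a, b⟩ := p
  obtain ⟨a, rfl⟩ := Nat.exists_eq_add_of_le' h1
  obtain ⟨c, rfl⟩ := Nat.exists_eq_add_of_le' he
  have : ((c + 2 : ℕ) : ZMod (c + 2)) = 0 := ZMod.natCast_self _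
  unfold res lad
  push_cast at this
  have h : (c : ZMod (c+2)) = -2 := by linear_combination this
  simp only [Nat.add_sub_cancel, show c + 2 - 1 = c + 1 by omega]
  push_cast
  rw [h]
  ring

theorem res_eq_iff (e : ℕ) (he : 2 ≤ e) (p q : ℕ × ℕ) (h1 : 1 ≤ p.1) (h2 : 1 ≤ q.1) :
    res e p = res e q ↔ lad e p ≡ lad e q [MOD e] := by
  rw [res_lad e he p h1, res_lad e he q h2, sub_left_inj, ZMod.natCast_eq_natCast_iff]

/-- block index -/
noncomputable def blk (e : ℕ) (l : ℕ → ℕ) (s : ℕ) : ℕ := sInf {m : ℕ | s ≤ Rlad e l m}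

theorem modEq_le {e a b : ℕ} (h : a ≡ b [MOD e]) (h' : a < b + e) : a ≤ b := by
  by_contra hlt
  have h1 := (Nat.modEq_iff_dvd' (by omega : b ≤ a)).1 h.symm
  have := Nat.le_of_dvd (by omega) h1
  omega

theorem cells_diagram (l : ℕ → ℕ) (hl : IsPartitionFun l) : IsDiagram (cells l) := by
  refine ⟨fun p hp => ⟨hp.1, hp.2.1⟩, ?_⟩
  intro a b a' b' h h1 h2 h3 h4
  refine ⟨h1, h3, ?_⟩
  have : ∀ k, l (a' + k) ≤ l a' := by
    intro k
    induction k with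
    | zero => simp
    | succ k ih => exact (hl.1 (a' + k) (by omega)).trans ih
  have h5 := this (a - a')
  rw [Nat.add_sub_cancel' h2] at h5
  have := h.2.2
  simp only at this ⊢
  omega

theorem restr_bound (e : ℕ) (he : 2 ≤ e) (l : ℕ → ℕ) (hr : IsRestricted e l) (a k : ℕ) (ha : 1 ≤ a) :
    l a ≤ l (a + k) + k * (e - 1) := by
  induction k with
  | zero => simp
  | succ k ih =>
    have := hr (a + k) (by omega)
    rw [Nat.add_mul, ← Nat.add_assoc a k 1]
    omega

theorem Rlad_eq (e : ℕ) (l : ℕ → ℕ) (X : Finset (ℕ × ℕ)) (hX : (X : Set (ℕ × ℕ)) = cells l) :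
    (∀ u, (cells l ∩ ladder e u).ncard = (X.filter (fun p => lad e p = u)).card) ∧
    ∀ m, Rlad e l m = (X.filter (fun p => lad e p ≤ m)).card := by
  have hmem : ∀ p, p ∈ X ↔ p ∈ cells l := fun p => by rw [← hX]; simp
  have h1 : ∀ u, (cells l ∩ ladder e u).ncard = (X.filter (fun p => lad e p = u)).card := by
    intro u
    rw [← Set.ncard_coe_finset]
    congr 1
    ext p
    simp only [Set.mem_inter_iff, Finset.coe_filter, Set.mem_ofPred_eq, hmem]
    constructor
    · rintro ⟨h, h'⟩
      exact ⟨h, (mem_ladder e u p h.1 h.2.1).1 h'⟩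
    · rintro ⟨h, h'⟩
      exact ⟨h, (mem_ladder e u p h.1 h.2.1).2 h'⟩
  refine ⟨h1, ?_⟩
  intro m
  unfold Rlad
  simp only [h1]
  have : ∀ p ∈ X.filter (fun p => lad e p ≤ m), lad e p ∈ Finset.Icc 1 m := by
    intro p hp
    obtain ⟨hp, hm⟩ := Finset.mem_filter.1 hp
    have := ((hmem p).1 hp).2.1
    rw [Finset.mem_Icc]
    refine ⟨?_, hm⟩
    unfold lad
    omega
  rw [Finset.card_eq_sum_card_fiberwise this]
  apply Finset.sum_congr rfl
  intro u hu
  rw [Finset.filter_filter]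
  congr 1
  ext p
  simp only [Finset.mem_filter, Finset.mem_Icc] at hu ⊢
  constructor
  · rintro ⟨a, b⟩; exact ⟨a, by omega, b⟩
  · rintro ⟨a, _, b⟩; exact ⟨a, b⟩

theorem LW_eq (e d : ℕ) (he : 2 ≤ e) (l : ℕ → ℕ) (hl : IsPartitionFun l) (X : Finset (ℕ × ℕ))
    (hX : (X : Set (ℕ × ℕ)) = cells l) (hd : X.card = d) :
    LWTableaux e d l (cells l) = Tab (lad e) X := by
  have hmem : ∀ p, p ∈ X ↔ p ∈ cells l := fun p => by rw [← hX]; simp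
  have hR := (Rlad_eq e l X hX).2
  have hDg := cells_diagram l hl
  have hRle : ∀ m, Rlad e l m ≤ X.card := by
    intro m; rw [hR]; exact Finset.card_filter_le _ _
  have hRmono : ∀ m m', m ≤ m' → Rlad e l m ≤ Rlad e l m' := by
    intro m m' h
    rw [hR, hR]
    apply Finset.card_le_card
    intro p
    simp only [Finset.mem_filter]
    rintro ⟨a, b⟩; exact ⟨a, by omega⟩
  have hne : ∀ s, s ≤ X.card → {m : ℕ | s ≤ Rlad e l m}.Nonempty := by
    intro s hs
    refine ⟨X.sup (lad e), ?_⟩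
    change s ≤ _
    rw [hR, Finset.filter_true_of_mem]
    · exact hs
    · intro p hp; exact Finset.le_sup hp
  have hblk : ∀ s, s ≤ X.card → ∀ m, blk e l s ≤ m ↔ s ≤ Rlad e l m := by
    intro s hs m
    constructor
    · intro h
      have : s ≤ Rlad e l (blk e l s) := Nat.sInf_mem (hne s hs)
      exact this.trans (hRmono _ _ h)
    · intro h; exact Nat.sInf_le h
  have hblk1 : ∀ s, 1 ≤ s → s ≤ X.card → 1 ≤ blk e l s := by
    intro s h1 hs
    by_contra h
    have := (hblk s hs 0).1 (by omega)
    have h0 : Rlad e l 0 = 0 := by simp [Rlad]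
    omega
  have hlw : ∀ s, 1 ≤ s → s ≤ X.card → ladderWeight e l s = (blk e l s : ZMod e) - 1 := by
    intro s h1 hs
    have := hblk1 s h1 hs
    change ((blk e l s - 1 : ℕ) : ZMod e) = _
    rw [Nat.cast_sub this]; simp
  ext T
  constructor
  · rintro ⟨⟨h1, h2, h3, h4, h5⟩, h6, h7⟩
    have h1' : ∀ p ∈ X, 1 ≤ T p ∧ T p ≤ X.card := by
      intro p hp; rw [hd]; exact h1 p ((hmem p).1 hp)
    have h2' : Set.InjOn T (X : Set (ℕ × ℕ)) := by
      rw [hX]; intro p hp q hq; exact h2 p hp q hq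
    have hmod : ∀ p ∈ X, lad e p ≡ blk e l (T p) [MOD e] := by
      intro p hp
      have := h7 p ((hmem p).1 hp)
      rw [hlw _ (h1' p hp).1 (h1' p hp).2, res_lad e he p ((hmem p).1 hp).1, sub_left_inj,
        ZMod.natCast_eq_natCast_iff] at this
      exact this
    have bmono : ∀ s s', s ≤ s' → s' ≤ X.card → blk e l s ≤ blk e l s' := by
      intro s s' h h'
      rw [hblk s (h.trans h')]
      exact h.trans ((hblk s' h' _).1 le_rfl)
    have hle : ∀ n, ∀ p ∈ X, T p = n → lad e p ≤ blk e l (T p) := by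
      intro n
      induction n using Nat.strong_induction_on with
      | _ n ih =>
        rintro ⟨a, b⟩ hp hTp
        have hpc := (hmem _).1 hp
        have ha : 1 ≤ a := hpc.1
        have hb : 1 ≤ b := hpc.2.1
        have hm := hmod _ hp
        have hb1 := hblk1 _ (h1' _ hp).1 (h1' _ hp).2
        by_cases hb2 : 2 ≤ b
        · obtain ⟨b, rfl⟩ := Nat.exists_eq_add_of_le' hb
          have hq : (a, b) ∈ cells l := hDg.2 a (b+1) a b hpc ha le_rfl (by omega) (by omega)
          have hlt := h4 a b hq hpc
          have hq' := (hmem _).2 hq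
          have hi := ih _ (hTp ▸ hlt) (a, b) hq' rfl
          have hmono := bmono _ _ hlt.le (h1' _ hp).2
          have hlad : lad e (a, b + 1) = lad e (a, b) + 1 := by unfold lad; simp only; omega
          rw [hlad] at hm ⊢
          apply modEq_le hm
          omega
        · by_cases ha2 : 2 ≤ a
          · obtain ⟨a, rfl⟩ := Nat.exists_eq_add_of_le' ha
            have hq : (a, b) ∈ cells l := hDg.2 (a+1) b a b hpc (by omega) (by omega) (by omega) le_rfl
            have hlt := h5 a b hq hpc
            have hq' := (hmem _).2 hq
            have hi := ih _ (hTp ▸ hlt) (a, b) hq' rfl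
            have hmono := bmono _ _ hlt.le (h1' _ hp).2
            have hlad : lad e (a + 1, b) = lad e (a, b) + (e - 1) := by
              obtain ⟨a, rfl⟩ := Nat.exists_eq_add_of_le' (show 1 ≤ a by omega)
              unfold lad
              simp only [Nat.add_sub_cancel]
              ring
            rw [hlad] at hm ⊢
            apply modEq_le hm
            omega
          · have : a = 1 := by omega
            have : b = 1 := by omega
            subst a b
            simp only [lad]
            omega
    have heq : ∀ m, X.filter (fun p => T p ≤ Rlad e l m) = X.filter (fun p => lad e p ≤ m) := by
      intro m
      apply Finset.eq_of_subset_of_card_le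
      · intro p hp
        obtain ⟨hp, h⟩ := Finset.mem_filter.1 hp
        exact Finset.mem_filter.2 ⟨hp, (hle _ p hp rfl).trans ((hblk _ (h1' p hp).2 m).2 h)⟩
      · rw [(count_le X T h1' h2').2 _ (hRle m), hR]
    refine ⟨h1', h2', fun p hp => h6 p (fun h => hp ((hmem p).2 h)), ?_⟩
    intro p hp q hq hpq
    have hp' : p ∈ X.filter (fun r => T r ≤ Rlad e l (lad e p)) := by
      rw [heq]; exact Finset.mem_filter.2 ⟨hp, le_rfl⟩
    have hq' : ¬ q ∈ X.filter (fun r => T r ≤ Rlad e l (lad e p)) := by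
      rw [heq]
      intro h
      have := (Finset.mem_filter.1 h).2
      omega
    have h8 := (Finset.mem_filter.1 hp').2
    have h9 : ¬ T q ≤ Rlad e l (lad e p) := fun h => hq' (Finset.mem_filter.2 ⟨hq, h⟩)
    omega
  · rintro ⟨h1, h2, h3, h4⟩
    have hc := count_le X T h1 h2
    refine ⟨⟨?_, ?_, ?_, ?_, ?_⟩, fun p hp => h3 p (fun h => hp ((hmem p).1 h)), ?_⟩
    · intro p hp; rw [← hd]; exact h1 p ((hmem p).2 hp)
    · intro p hp q hq; rw [← hX] at hp hq; exact h2 hp hq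
    · intro s hs hs'
      obtain ⟨p, hp, h⟩ := hc.1 s hs (hd ▸ hs')
      exact ⟨p, (hmem p).1 hp, h⟩
    · intro a b hp hq
      exact h4 _ ((hmem _).2 hp) _ ((hmem _).2 hq) (lad_lt e he hp.1 le_rfl (by omega) (by simp))
    · intro a b hp hq
      exact h4 _ ((hmem _).2 hp) _ ((hmem _).2 hq) (lad_lt e he hp.1 (by omega) le_rfl (by simp))
    · intro p hp
      have hp' := (hmem p).2 hp
      have hb := h1 p hp'
      have hiff : ∀ m, blk e l (T p) ≤ m ↔ lad e p ≤ m := by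
        intro m
        rw [hblk _ hb.2, hR]
        constructor
        · intro h
          by_contra hlt
          have hsub : X.filter (fun q => lad e q ≤ m) ⊆ X.filter (fun q => T q ≤ T p - 1) := by
            intro q hq
            obtain ⟨hq, hqm⟩ := Finset.mem_filter.1 hq
            have := h4 q hq p hp' (by omega)
            exact Finset.mem_filter.2 ⟨hq, by omega⟩
          have := Finset.card_le_card hsub
          rw [hc.2 _ (by omega)] at this
          omega
        · intro h
          have hsub : X.filter (fun q => T q ≤ T p) ⊆ X.filter (fun q => lad e q ≤ m) := by
            intro q hq
            obtain ⟨hq, hqm⟩ := Finset.mem_filter.1 hq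
            refine Finset.mem_filter.2 ⟨hq, ?_⟩
            by_contra hlt
            have := h4 p hp' q hq (by omega)
            omega
          have := Finset.card_le_card hsub
          rwa [hc.2 _ hb.2] at this
      have : blk e l (T p) = lad e p :=
        le_antisymm ((hiff _).2 le_rfl) ((hiff _).1 le_rfl)
      rw [hlw _ hb.1 hb.2, this, res_lad e he p hp.1]

theorem deg_eq (e : ℕ) (he : 2 ≤ e) (l : ℕ → ℕ) (hl : IsPartitionFun l)
    (hr : IsRestricted e l) (X : Finset (ℕ × ℕ))
    (hX : (X : Set (ℕ × ℕ)) = cells l) (T : ℕ × ℕ → ℕ) (hT : T ∈ Tab (lad e) X) :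
    degTab e (cells l) T = wt (lad e) Prod.fst X T := by
  have hmem : ∀ p, p ∈ X ↔ p ∈ cells l := fun p => by rw [← hX]; simp
  have hDg := cells_diagram l hl
  obtain ⟨h1, h2, h3, h4⟩ := hT
  unfold degTab wt
  rw [← hX, finsum_mem_coe_finset]
  apply Finset.sum_congr rfl
  rintro ⟨a0, b0⟩ hp
  have hpc := (hmem _).1 hp
  have ha0 : 1 ≤ a0 := hpc.1
  have hbl : b0 ≤ l a0 := hpc.2.2
  set p := (a0, b0) with hpdef
  set S : Set (ℕ × ℕ) := {q | q ∈ (X : Set (ℕ × ℕ)) ∧ T q ≤ T p} with hS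
  have hSX : ∀ q, q ∈ S → q ∈ X := fun q hq => hq.1
  have hSlad : ∀ q, q ∈ S → lad e q ≤ lad e p := by
    rintro q ⟨hq, hq'⟩
    by_contra h
    have := h4 p hp q hq (by omega)
    omega
  have hladS : ∀ q ∈ X, lad e q < lad e p → q ∈ S := by
    intro q hq h
    exact ⟨hq, (h4 q hq p hp h).le⟩
  have hSD : IsDiagram S := by
    refine ⟨fun q hq => hDg.1 q ((hmem q).1 hq.1), ?_⟩
    intro a b a' b' h ha ha' hb hb'
    by_cases heq : (a', b') = (a, b)
    · rw [heq]; exact h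
    · have hc : (a', b') ∈ X := (hmem _).2 (hDg.2 a b a' b' ((hmem _).1 h.1) ha ha' hb hb')
      have := h4 _ hc _ h.1 (lad_lt e he ha ha' hb' heq)
      exact ⟨hc, this.le.trans h.2⟩
  -- nodes below `p` outside the diagram have large ladder index
  have hout : ∀ a b, a0 < a → l a < b → lad e p < lad e (a, b) := by
    intro a b ha hb
    obtain ⟨k, rfl⟩ := Nat.exists_eq_add_of_le ha.le
    have := restr_bound e he l hr a0 k ha0
    unfold lad
    simp only [hpdef]
    have h' : (a0 + k - 1) * (e - 1) = (a0 - 1) * (e - 1) + k * (e - 1) := by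
      rw [← Nat.add_mul]; congr 1; omega
    rw [h']
    omega
  have hadd : {B | Addable S B ∧ res e B = res e p ∧ p.1 < B.1} =
      ((X.filter (fun q => (lad e q = lad e p ∧ p.1 < q.1) ∧ T p < T q) : Finset (ℕ × ℕ)) :
        Set (ℕ × ℕ)) := by
    ext ⟨a, b⟩
    simp only [Set.mem_ofPred_eq, Finset.coe_filter]
    constructor
    · rintro ⟨⟨hB, hBD⟩, hres, hlt⟩
      have hlt' : a0 < a := hlt
      have hb : 1 ≤ b := (hBD.1 (a, b) (by simp)).2
      rw [res_eq_iff e he _ _ (show 1 ≤ a by omega) ha0] at hres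
      have hle : lad e (a, b) ≤ lad e p := by
        apply modEq_le hres
        by_cases hb2 : 2 ≤ b
        · have hq := hBD.2 a b a (b - 1) (by simp) (by omega) le_rfl (by omega) (by omega)
          have hq : (a, b - 1) ∈ S := by
            rcases hq with hq | hq
            · exact hq
            · simp only [Set.mem_singleton_iff, Prod.mk.injEq] at hq; omega
          have := hSlad _ hq
          have hlad : lad e (a, b) = lad e (a, b - 1) + 1 := by unfold lad; simp only; omega
          omega
        · have hq := hBD.2 a b (a - 1) b (by simp) (by omega) (by omega) (by omega) le_rfl
          have hq : (a - 1, b) ∈ S := by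
            rcases hq with hq | hq
            · exact hq
            · simp only [Set.mem_singleton_iff, Prod.mk.injEq] at hq; omega
          have := hSlad _ hq
          have hlad : lad e (a, b) = lad e (a - 1, b) + (e - 1) := by
            obtain ⟨a, rfl⟩ := Nat.exists_eq_add_of_le' (show 2 ≤ a by omega)
            unfold lad
            simp only [show a + 2 - 1 = a + 1 by omega, show a + 1 - 1 = a by omega]
            ring
          omega
      have hBX : (a, b) ∈ X := by
        rw [hmem]
        refine ⟨show 1 ≤ a by omega, hb, ?_⟩
        by_contra h
        have := hout a b hlt' (by simpa using h)
        omega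
      have hTB : T p < T (a, b) := by
        by_contra h
        exact hB ⟨hBX, by omega⟩
      refine ⟨hBX, ⟨?_, hlt⟩, hTB⟩
      by_contra h
      have := h4 _ hBX p hp (by omega)
      omega
    · rintro ⟨hBX, ⟨hlad, hlt⟩, hTB⟩
      have hBc := (hmem _).1 hBX
      refine ⟨⟨fun h => by have := h.2; omega, ?_, ?_⟩, ?_, hlt⟩
      · rintro q (hq | hq)
        · exact hSD.1 q hq
        · rw [Set.mem_singleton_iff] at hq
          subst hq
          exact ⟨hBc.1, hBc.2.1⟩
      · rintro x y x' y' (hq | hq) g1 g2 g3 g4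
        · exact Or.inl (hSD.2 x y x' y' hq g1 g2 g3 g4)
        · rw [Set.mem_singleton_iff, Prod.mk.injEq] at hq
          obtain ⟨rfl, rfl⟩ := hq
          by_cases heq : (x', y') = (x, y)
          · exact Or.inr heq
          · left
            apply hladS
            · exact (hmem _).2 (hDg.2 x y x' y' hBc g1 g2 g3 g4)
            · rw [← hlad]; exact lad_lt e he g1 g2 g4 heq
      · rw [res_eq_iff e he _ _ hBc.1 ha0, hlad]
  have hrem : {B | Removable S B ∧ res e B = res e p ∧ p.1 < B.1} =
      ((X.filter (fun q => (lad e q = lad e p ∧ p.1 < q.1) ∧ T q < T p) : Finset (ℕ × ℕ)) :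
        Set (ℕ × ℕ)) := by
    ext ⟨a, b⟩
    simp only [Set.mem_ofPred_eq, Finset.coe_filter]
    constructor
    · rintro ⟨⟨hB, hBD⟩, hres, hlt⟩
      have hlt' : a0 < a := hlt
      have hb : 1 ≤ b := (hSD.1 _ hB).2
      rw [res_eq_iff e he _ _ (show 1 ≤ a by omega) ha0] at hres
      have hle := hSlad _ hB
      refine ⟨hB.1, ⟨?_, hlt⟩, ?_⟩
      · by_contra hne
        have hlad : lad e (a, b + 1) = lad e (a, b) + 1 := by unfold lad; simp only; omega
        have hge : ¬ lad e p < lad e (a, b) + e := fun h => by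
          have := modEq_le hres.symm h
          omega
        have hnot : (a, b + 1) ∉ S := by
          intro h
          have := hBD.2 a (b + 1) a b ⟨h, by simp⟩ (by omega) le_rfl hb (by omega)
          exact this.2 rfl
        have hnX : (a, b + 1) ∉ X := fun h => hnot (hladS _ h (by omega))
        have : l a < b + 1 := by
          by_contra h
          exact hnX ((hmem _).2 ⟨show 1 ≤ a by omega, show 1 ≤ b + 1 by omega,
            show b + 1 ≤ l a by omega⟩)
        have := hout a (b + 1) hlt' this
        omega
      · refine lt_of_le_of_ne hB.2 ?_
        intro h
        have := h2 hB.1 hp h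
        rw [hpdef, Prod.mk.injEq] at this
        omega
    · rintro ⟨hBX, ⟨hlad, hlt⟩, hTB⟩
      have hBc := (hmem _).1 hBX
      refine ⟨⟨⟨hBX, hTB.le⟩, ?_, ?_⟩, ?_, hlt⟩
      · rintro q hq
        exact hSD.1 q hq.1
      · rintro x y x' y' hq g1 g2 g3 g4
        refine ⟨hSD.2 x y x' y' hq.1 g1 g2 g3 g4, ?_⟩
        intro h
        rw [Set.mem_singleton_iff] at h
        by_cases heq : (x', y') = (x, y)
        · exact hq.2 (heq ▸ h)
        · have := lad_lt e he g1 g2 g4 heq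
          have := hSlad _ hq.1
          rw [h] at *
          omega
      · rw [res_eq_iff e he _ _ hBc.1 ha0, hlad]
  unfold degNode
  rw [hadd, hrem, Set.ncard_coe_finset, Set.ncard_coe_finset, Finset.card_filter,
    Finset.card_filter]
  push_cast
  rw [← Finset.sum_sub_distrib]
  apply Finset.sum_congr rfl
  intro q hq
  unfold hh
  split_ifs <;> first | rfl | omega

/-- the multiplicity of the ladder weight `j^λ` in the graded character
of the Specht module `S(λ)` equals `r_λ = ∏_m [r_m(λ)]_q!`. -/
theorem ladder_weight_multiplicity
    (e d : ℕ) (he : 2 ≤ e) (l : ℕ → ℕ)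
    (hl : IsPartitionOf l d) (hrestr : IsRestricted e l)
    (t : ℕ) (htmax : ∀ u, (cells l ∩ ladder e u).Nonempty → u ≤ t) :
    ∑ᶠ T ∈ LWTableaux e d l (cells l), LaurentPolynomial.T (degTab e (cells l) T) =
      ∏ u ∈ Finset.Icc 1 t, qfact ((cells l ∩ ladder e u).ncard) := by
  obtain ⟨hlp, hfin, hcard⟩ := hl
  set X := hfin.toFinset with hXdef
  have hX : (X : Set (ℕ × ℕ)) = cells l := hfin.coe_toFinset
  have hd : X.card = d := by rw [← hcard, ← hX, Set.ncard_coe_finset]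
  have hmem : ∀ p, p ∈ X ↔ p ∈ cells l := fun p => by rw [← hX]; simp
  rw [LW_eq e d he l hlp X hX hd]
  have hdeg : ∀ T ∈ Tab (lad e) X, LaurentPolynomial.T (R := ℤ) (degTab e (cells l) T) =
      LaurentPolynomial.T (wt (lad e) Prod.fst X T) := by
    intro T hT
    rw [deg_eq e he l hlp hrestr X hX T hT]
  rw [finsum_mem_congr rfl hdeg,
    (tab_sum (lad e) Prod.fst _ X rfl (fun p _ q _ => lad_inj e p q)).2 (Finset.Icc 1 t)]
  · apply Finset.prod_congr rfl
    intro u _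
    rw [(Rlad_eq e l X hX).1]
  · intro p hp
    have hpc := (hmem p).1 hp
    rw [Finset.mem_Icc]
    refine ⟨?_, htmax _ ⟨p, hpc, (mem_ladder e _ p hpc.1 hpc.2.1).2 rfl⟩⟩
    have := hpc.2.1
    unfold lad
    omega

end KN
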